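/- Let a, b ∈ K with f(a) = b^d and b ≠ 0. Then in the Dedekind domain A, the principal ideal generated by the image of X − a equals the product, over all d-th roots of unity ζ in K, of the d pairwise distinct maximal ideals m_{(a,ζb)} = (X − a, Y − ζb). -/

import Mathlib

open Polynomial

/-- The affine coordinate ring `A = K[X,Y]/(Y^d − f(X))` of the curve `y^d = f(x)`,
realized as `AdjoinRoot` of the polynomial `Y^d - f(X)` over `K[X]`. -/
noncomputable abbrev CurveRing (K : Type*) [Field K] (d : ℕ) (f : K[X]) : Type _ :=
  AdjoinRoot ((X : K[X][X]) ^ d - C f)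

/-- The maximal ideal `m_{(a,c)} = (X - a, Y - c)` of the coordinate ring. -/
noncomputable def ptIdeal {K : Type*} [Field K] (d : ℕ) (f : K[X]) (a c : K) :
    Ideal (CurveRing K d f) :=
  Ideal.span {AdjoinRoot.of _ (X - C a), AdjoinRoot.root _ - AdjoinRoot.of _ (C c)}

/-- `P = (a,c)` is a torsion point of order `m` on the Jacobian: `m` is the least
positive integer such that `m_P ^ m` is a principal ideal of `A`. -/
def IsTorsionOfOrder {K : Type*} [Field K] (d : ℕ) (f : K[X]) (a c : K) (m : ℕ) : Prop :=
  IsLeast {k : ℕ | 0 < k ∧ (ptIdeal d f a c ^ k).IsPrincipal} m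

theorem Ideal.prod_span_pair_le_span_pair_prod {R ι : Type*} [CommRing R] (s : Finset ι) (x : R)
    (u : ι → R) : ∏ i ∈ s, Ideal.span {x, u i} ≤ Ideal.span {x, ∏ i ∈ s, u i} := by
  classical
  induction s using Finset.induction_on with
  | empty => simp [Ideal.span_insert]
  | insert i s hi ih =>
    rw [Finset.prod_insert hi, Finset.prod_insert hi]
    refine (Ideal.mul_mono_right ih).trans ?_
    rw [Ideal.span_pair_mul_span_pair, Ideal.span_le]
    have hx : x ∈ Ideal.span {x, u i * ∏ j ∈ s, u j} := Ideal.subset_span (by simp)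
    rintro y (rfl | rfl | rfl | rfl)
    · exact Ideal.mul_mem_left _ _ hx
    · exact Ideal.mul_mem_right _ _ hx
    · exact Ideal.mul_mem_left _ _ hx
    · exact Ideal.subset_span (by simp)

theorem IsPrimitiveRoot.prod_sub_algebraMap_mul {K R : Type*} [Field K] [CommRing R] [Algebra K R]
    {d : ℕ} {ζ : K} (hζ : IsPrimitiveRoot ζ d) (hd : 0 < d) {b : K} (hb : b ≠ 0) (y : R) :
    ∏ ω ∈ nthRootsFinset d (1 : K), (y - algebraMap K R (ω * b)) =
      y ^ d - algebraMap K R (b ^ d) := by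
  have hinv : algebraMap K R b * algebraMap K R b⁻¹ = 1 := by
    rw [← map_mul, mul_inv_cancel₀ hb, map_one]
  have key := congrArg (fun p => algebraMap K R b ^ d * aeval (algebraMap K R b⁻¹ * y) p)
    (X_pow_sub_one_eq_prod hd hζ)
  simp only [map_sub, map_pow, map_prod, aeval_X, aeval_C, map_one] at key
  calc ∏ ω ∈ nthRootsFinset d (1 : K), (y - algebraMap K R (ω * b))
      = ∏ ω ∈ nthRootsFinset d (1 : K),
          algebraMap K R b * (algebraMap K R b⁻¹ * y - algebraMap K R ω) :=
        Finset.prod_congr rfl fun ω _ => by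
          rw [map_mul]; linear_combination -y * hinv
    _ = algebraMap K R b ^ d * ((algebraMap K R b⁻¹ * y) ^ d - 1) := by
        rw [Finset.prod_mul_distrib, Finset.prod_const, hζ.card_nthRootsFinset, key]
    _ = y ^ d - algebraMap K R (b ^ d) := by
        rw [mul_sub, ← mul_pow, ← mul_assoc, hinv, one_mul, mul_one, map_pow]

theorem ptIdeal_ne_top {K : Type*} [Field K] {d : ℕ} {f : K[X]} {a c : K}
    (h : f.eval a = c ^ d) : ptIdeal d f a c ≠ ⊤ := by
  let φ : CurveRing K d f →+* K := AdjoinRoot.lift (evalRingHom a) c (by simp [h])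
  have hle : ptIdeal d f a c ≤ RingHom.ker φ := by
    rw [ptIdeal, Ideal.span_le]
    rintro x (rfl | rfl) <;> simp [φ, RingHom.mem_ker]
  exact fun htop => RingHom.ker_ne_top φ (top_le_iff.mp (htop ▸ hle))

theorem isCoprime_ptIdeal {K : Type*} [Field K] (d : ℕ) (f : K[X]) (a : K) {c c' : K}
    (h : c ≠ c') : IsCoprime (ptIdeal d f a c) (ptIdeal d f a c') := by
  rw [Ideal.isCoprime_iff_exists]
  let ι : K →+* CurveRing K d f := (AdjoinRoot.of _).comp C
  have hinv : ι (c' - c)⁻¹ * (ι c' - ι c) = 1 := by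
    rw [← map_sub, ← map_mul, inv_mul_cancel₀ (sub_ne_zero.mpr h.symm), map_one]
  refine ⟨ι (c' - c)⁻¹ * (AdjoinRoot.root _ - ι c),
    Ideal.mul_mem_left _ _ (Ideal.subset_span (by simp [ι])),
    -ι (c' - c)⁻¹ * (AdjoinRoot.root _ - ι c'),
    Ideal.mul_mem_left _ _ (Ideal.subset_span (by simp [ι])), ?_⟩
  linear_combination hinv

theorem stmt_4 {K : Type*} [Field K] [IsAlgClosed K] (d n : ℕ)
    (hd : 2 ≤ d) (hdn : d < n) (hgcd : Nat.gcd n d = 1)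
    (hchar : ¬ (ringChar K ∣ d))
    (f : K[X]) (hmonic : f.Monic) (hdeg : f.natDegree = n) (hsqf : Squarefree f)
    (hDed : IsDedekindDomain (CurveRing K d f))
    (a b : K) (hab : f.eval a = b ^ d) (hb : b ≠ 0) :
    Set.InjOn (fun ζ : K => ptIdeal d f a (ζ * b)) (nthRootsFinset d (1 : K)) ∧
    Ideal.span {AdjoinRoot.of ((X : K[X][X]) ^ d - C f) (X - C a)} =
      ∏ ζ ∈ nthRootsFinset d (1 : K), ptIdeal d f a (ζ * b) := by
  have hd0 : 0 < d := by omega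
  have hcop : ∀ ζ ω : K, ζ ≠ ω → IsCoprime (ptIdeal d f a (ζ * b)) (ptIdeal d f a (ω * b)) :=
    fun ζ ω hne => isCoprime_ptIdeal d f a fun h => hne (mul_right_cancel₀ hb h)
  constructor
  · intro ζ hζ ω _ heq
    by_contra hne
    have htop := (hcop ζ ω hne).sup_eq
    rw [← show ptIdeal d f a (ζ * b) = ptIdeal d f a (ω * b) from heq, sup_idem] at htop
    refine ptIdeal_ne_top ?_ htop
    rw [mul_pow, (mem_nthRootsFinset hd0 1).mp hζ, one_mul, hab]
  · apply le_antisymm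
    · rw [Ideal.prod_eq_iInf_of_pairwise_isCoprime fun ζ _ ω _ hne => hcop ζ ω hne]
      exact le_iInf₂ fun ζ _ => Ideal.span_mono (by simp)
    · have : NeZero (d : K) := ⟨fun h => hchar ((ringChar.spec K d).mp h)⟩
      obtain ⟨ζ, hζ⟩ := HasEnoughRootsOfUnity.exists_primitiveRoot K d
      refine (Ideal.prod_span_pair_le_span_pair_prod _ _ _).trans ?_
      have hprod := hζ.prod_sub_algebraMap_mul hd0 hb
        (AdjoinRoot.root ((X : K[X][X]) ^ d - C f))
      have hroot : AdjoinRoot.root ((X : K[X][X]) ^ d - C f) ^ d = AdjoinRoot.of _ f := by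
        have := AdjoinRoot.eval₂_root ((X : K[X][X]) ^ d - C f)
        simpa [sub_eq_zero] using this
      have halg : ∀ c : K, algebraMap K (CurveRing K d f) c = AdjoinRoot.of _ (C c) :=
        fun c => rfl
      simp only [halg, hroot, ← hab] at hprod
      rw [hprod, ← map_sub, Ideal.span_le]
      rintro y (rfl | rfl)
      · exact Ideal.mem_span_singleton_self _
      · exact Ideal.mem_span_singleton.mpr (map_dvd _ X_sub_C_dvd_sub_C_eval)
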